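/- arXiv:1002.1229 — 2 statements merged into one kernel-verified Lean document; each statement's English description precedes it below -/
import Mathlib

section
/- For every i ≥ 0, the number of Schröder prefixes in 𝒟 terminating at the point (i,i) equals the cardinality of D_i, i.e., a_i = |D_i|. -/
/-- A step of a lattice path: `E = (1,0)`, `N = (0,1)`, `D = (1,1)`. -/
inductive Step : Type
  | E : Step
  | N : Step
  | D : Step
  deriving DecidableEq

/-- The x-coordinate of the lattice point reached after performing the steps `q`
(starting from the origin). -/
def posX (q : List Step) : ℕ := q.count Step.E + q.count Step.D

/-- The y-coordinate of the lattice point reached after performing the steps `q`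
(starting from the origin). -/
def posY (q : List Step) : ℕ := q.count Step.N + q.count Step.D

/-- A Schröder prefix: a lattice path starting at the origin which never passes
below the line `y = x`. -/
def IsSchroderPrefix (p : List Step) : Prop :=
  ∀ q : List Step, q <+: p → posX q ≤ posY q

/-- A Schröder path of length `n`: a Schröder prefix terminating at `(n, n)`. -/
def IsSchroderPath (n : ℕ) (p : List Step) : Prop :=
  IsSchroderPrefix p ∧ posX p = n ∧ posY p = n

/-- Interchange `E` and `N` steps. -/
def revStep : Step → Step
  | Step.E => Step.N
  | Step.N => Step.E
  | Step.D => Step.D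

/-- The reversal of a Schröder path: write the steps in reverse order and
interchange `E` and `N` steps. -/
def revPath (p : List Step) : List Step := p.reverse.map revStep

/-- Words which are concatenations of blocks, each block being a single `D` step or
of the form `N^k E^k` for some `k > 0`. -/
inductive IsInnerWord : List Step → Prop
  | nil : IsInnerWord []
  | dcons {p : List Step} : IsInnerWord p → IsInnerWord (Step.D :: p)
  | peak {k : ℕ} {p : List Step} : 0 < k → IsInnerWord p →
      IsInnerWord (List.replicate k Step.N ++ List.replicate k Step.E ++ p)

/-- Words which are concatenations of blocks, each block being a single `D` step or of
the form `N q E` where `q` is an inner word. -/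
inductive IsDWord : List Step → Prop
  | nil : IsDWord []
  | dcons {p : List Step} : IsDWord p → IsDWord (Step.D :: p)
  | block {q p : List Step} : IsInnerWord q → IsDWord p →
      IsDWord (Step.N :: (q ++ Step.E :: p))

/-- Membership in `𝒟_n`: a Schröder path of length `n` of the prescribed block form. -/
def MemD (n : ℕ) (p : List Step) : Prop := IsDWord p ∧ IsSchroderPath n p

/-- Membership in `𝒟`: Schröder prefixes occurring as initial segments of some
path in `𝒟_m` for some finite `m`. -/
def MemCalD (p : List Step) : Prop := ∃ (m : ℕ) (q : List Step), p <+: q ∧ MemD m q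

/-- `p` has a level feature at `t`: a `D` step joining `(t-1, t)` to `(t, t+1)`. -/
def HasLevelFeatureAt (p : List Step) (t : ℕ) : Prop :=
  1 ≤ t ∧ ∃ q r : List Step, p = q ++ Step.D :: r ∧ posX q = t - 1 ∧ posY q = t

/-- `p` has a notch feature at `t`: an `E` step joining `(t-1, t)` to `(t, t)`
immediately followed by an `N` step joining `(t, t)` to `(t, t+1)`. -/
def HasNotchFeatureAt (p : List Step) (t : ℕ) : Prop :=
  1 ≤ t ∧ ∃ q r : List Step, p = q ++ Step.E :: Step.N :: r ∧ posX q = t - 1 ∧ posY q = t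

/-- `p` has no (level or notch) features. -/
def Featureless (p : List Step) : Prop :=
  ∀ t : ℕ, ¬ HasLevelFeatureAt p t ∧ ¬ HasNotchFeatureAt p t

/-- Auxiliary function for `psi`, processing the path left to right while keeping track of
the current height `y - x` above the diagonal: at height `1`, a `D` step (a level feature)
is replaced by `E N` (a notch feature) and vice versa; all other steps are unchanged. -/
def psiAux : ℕ → List Step → List Step
  | 1, Step.D :: rest => Step.E :: Step.N :: psiAux 1 rest
  | 1, Step.E :: Step.N :: rest => Step.D :: psiAux 1 rest
  | h, Step.N :: rest => Step.N :: psiAux (h + 1) rest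
  | h, Step.E :: rest => Step.E :: psiAux (h - 1) rest
  | h, Step.D :: rest => Step.D :: psiAux h rest
  | _, [] => []
  termination_by h l => l.length

/-- `psi p` replaces every level feature of `p` by a notch feature at the same place and
vice versa, leaving all other steps unchanged. -/
def psi (p : List Step) : List Step := psiAux 0 p

/-- `a i`: the number of Schröder prefixes in `𝒟` terminating at `(i, i)`. -/
noncomputable def aSeq (i : ℕ) : ℕ :=
  Set.ncard {p : List Step | MemCalD p ∧ posX p = i ∧ posY p = i}

/-- `b i`: the number of Schröder prefixes in `𝒟` terminating at `(i-1, i)` (and `b 0 = 0`). -/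
noncomputable def bSeq (i : ℕ) : ℕ :=
  Set.ncard {p : List Step | MemCalD p ∧ posX p + 1 = i ∧ posY p = i}

/-- `c i`: the number of featureless Schröder prefixes in `𝒟` terminating at `(i, i)`. -/
noncomputable def cSeq (i : ℕ) : ℕ :=
  Set.ncard {p : List Step | MemCalD p ∧ Featureless p ∧ posX p = i ∧ posY p = i}

/-- `d i`: the number of featureless Schröder prefixes in `𝒟` terminating at `(i-1, i)`
(and `d 0 = 0`). -/
noncomputable def dSeq (i : ℕ) : ℕ :=
  Set.ncard {p : List Step | MemCalD p ∧ Featureless p ∧ posX p + 1 = i ∧ posY p = i}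

/-- The permutation `π` (of `{1, …, n}`, 0-indexed as `Fin n`) contains the pattern `τ`
(a permutation of `{1, …, k}`, 0-indexed as `Fin k`). -/
def Contains {n k : ℕ} (π : Equiv.Perm (Fin n)) (τ : Equiv.Perm (Fin k)) : Prop :=
  ∃ f : Fin k → Fin n, StrictMono f ∧ ∀ a b : Fin k, τ a < τ b ↔ π (f a) < π (f b)

/-- The permutation `π` avoids the pattern `τ`. -/
def Avoids {n k : ℕ} (π : Equiv.Perm (Fin n)) (τ : Equiv.Perm (Fin k)) : Prop :=
  ¬ Contains π τ

/-- The reverse-complement of a permutation: `rc π (i) = (n+1) - π (n+1-i)` (1-indexed),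
i.e. `rc π (i) = rev (π (rev i))` in 0-indexed form. -/
def rc {n : ℕ} (π : Equiv.Perm (Fin n)) : Equiv.Perm (Fin n) :=
  (Fin.revPerm.trans π).trans Fin.revPerm

/-- The pattern `1243` (0-indexed: `0 ↦ 0, 1 ↦ 1, 2 ↦ 3, 3 ↦ 2`). -/
def pat1243 : Equiv.Perm (Fin 4) := Equiv.swap 2 3

/-- The pattern `2143` (0-indexed: `0 ↦ 1, 1 ↦ 0, 2 ↦ 3, 3 ↦ 2`). -/
def pat2143 : Equiv.Perm (Fin 4) := Equiv.swap 0 1 * Equiv.swap 2 3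

/-- The pattern `2134` (0-indexed: `0 ↦ 1, 1 ↦ 0, 2 ↦ 2, 3 ↦ 3`). -/
def pat2134 : Equiv.Perm (Fin 4) := Equiv.swap 0 1

theorem pre_app {α : Type*} (r a b : List α) (h : r <+: a ++ b) :
    r <+: a ∨ ∃ s, r = a ++ s ∧ s <+: b := by
  obtain ⟨t, ht⟩ := h
  rcases List.append_eq_append_iff.1 ht with ⟨u, h1, h2⟩ | ⟨u, h1, h2⟩
  · exact Or.inl ⟨u, h1.symm⟩
  · exact Or.inr ⟨u, h1, ⟨t, h2.symm⟩⟩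

theorem posX_app (a b : List Step) : posX (a ++ b) = posX a + posX b := by
  simp only [posX, List.count_append]; omega

theorem posY_app (a b : List Step) : posY (a ++ b) = posY a + posY b := by
  simp only [posY, List.count_append]; omega

theorem posX_E (a : List Step) : posX (Step.E :: a) = posX a + 1 := by
  simp [posX, List.count_cons]; omega
theorem posX_N (a : List Step) : posX (Step.N :: a) = posX a := by
  simp [posX, List.count_cons]
theorem posX_D (a : List Step) : posX (Step.D :: a) = posX a + 1 := by
  simp [posX, List.count_cons]; omega
theorem posY_E (a : List Step) : posY (Step.E :: a) = posY a := by
  simp [posY, List.count_cons]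
theorem posY_N (a : List Step) : posY (Step.N :: a) = posY a + 1 := by
  simp [posY, List.count_cons]; omega
theorem posY_D (a : List Step) : posY (Step.D :: a) = posY a + 1 := by
  simp [posY, List.count_cons]; omega

theorem inner_props {q : List Step} (h : IsInnerWord q) :
    posX q = posY q ∧ ∀ r, r <+: q → posX r ≤ posY r := by
  induction h with
  | nil => 
    refine ⟨rfl, fun r hr => ?_⟩
    rw [List.prefix_nil.1 hr]; exact le_refl _
  | dcons _ ih =>
    refine ⟨by rw [posX_D, posY_D, ih.1], fun r hr => ?_⟩
    rcases List.prefix_cons_iff.1 hr with rfl | ⟨s, rfl, hs⟩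
    · exact le_refl _
    · have := ih.2 s hs
      rw [posX_D, posY_D]; omega
  | @peak k p hk _ ih =>
    have hN : ∀ m, posX (List.replicate m Step.N) = 0 ∧ posY (List.replicate m Step.N) = m := by
      intro m; simp [posX, posY, List.count_replicate]
    have hE : ∀ m, posX (List.replicate m Step.E) = m ∧ posY (List.replicate m Step.E) = 0 := by
      intro m; simp [posX, posY, List.count_replicate]
    refine ⟨?_, fun r hr => ?_⟩
    · simp only [posX_app, posY_app, hN, hE, ih.1]; omega
    · rcases pre_app _ _ _ hr with h | ⟨s, rfl, hs⟩
      · rcases pre_app _ _ _ h with h | ⟨s, rfl, hs⟩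
        · obtain ⟨_, h⟩ := List.prefix_replicate_iff.1 h
          rw [h]; simp only [hN]; omega
        · obtain ⟨hl, h⟩ := List.prefix_replicate_iff.1 hs
          rw [h]; simp only [posX_app, posY_app, hN, hE]; omega
      · have := ih.2 s hs
        simp only [posX_app, posY_app, hN, hE]; omega

theorem dword_prefix {p : List Step} (h : IsDWord p) :
    ∀ r, r <+: p → posX r = posY r → IsDWord r := by
  induction h with
  | nil => 
    intro r hr _
    rw [List.prefix_nil.1 hr]; exact IsDWord.nil
  | dcons _ ih =>
    intro r hr hb
    rcases List.prefix_cons_iff.1 hr with rfl | ⟨s, rfl, hs⟩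
    · exact IsDWord.nil
    · rw [posX_D, posY_D] at hb
      exact IsDWord.dcons (ih s hs (by omega))
  | block hq _ ih =>
    intro r hr hb
    have hi := inner_props hq
    rcases List.prefix_cons_iff.1 hr with rfl | ⟨s, rfl, hs⟩
    · exact IsDWord.nil
    · rw [posX_N, posY_N] at hb
      rcases pre_app _ _ _ hs with h | ⟨t, rfl, ht⟩
      · have := hi.2 s h
        omega
      · rw [posX_app, posY_app] at hb
        rcases List.prefix_cons_iff.1 ht with rfl | ⟨u, rfl, hu⟩
        · have h1 : posX [] = 0 := rfl
          have h2 : posY [] = 0 := rfl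
          omega
        · rw [posX_E, posY_E] at hb
          exact IsDWord.block hq (ih u hu (by omega))

theorem stmt_7 :
    ∀ i : ℕ, aSeq i = Set.ncard {p : List Step | MemD i p} := by
  intro i
  unfold aSeq
  congr 1
  ext p
  constructor
  · rintro ⟨⟨m, q, hpq, hd, hs⟩, hx, hy⟩
    exact ⟨dword_prefix hd p hpq (hx.trans hy.symm),
      fun r hr => hs.1 r (hr.trans hpq), hx, hy⟩
  · intro h
    exact ⟨⟨i, p, List.prefix_refl p, h⟩, h.2.2⟩
end

section
/- The sequence b satisfies b_0 = 0, b_1 = 1, and b_{k+1} = 4 b_k − b_{k−1} for all k ≥ 1, where b_i is the number of Schröder prefixes in 𝒟 terminating at (i−1,i). -/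
/-- Words by state: `false` = height 0, `true` = height 1 at the base of an inner word. -/
inductive St10 : Bool → List Step → Prop
  | nil : St10 false []
  | ad {p} : St10 false p → St10 false (p ++ [Step.D])
  | be {p} : St10 true p → St10 false (p ++ [Step.E])
  | an {p} : St10 false p → St10 true (p ++ [Step.N])
  | bd {p} : St10 true p → St10 true (p ++ [Step.D])
  | bp {p} (k : ℕ) : 0 < k → St10 true p →
      St10 true (p ++ (List.replicate k Step.N ++ List.replicate k Step.E))

theorem posX_append10 (p q : List Step) : posX (p ++ q) = posX p + posX q := by
  simp [posX]; omega

theorem posY_append10 (p q : List Step) : posY (p ++ q) = posY p + posY q := by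
  simp [posY]; omega

theorem posX_repN10 (k : ℕ) : posX (List.replicate k Step.N) = 0 := by
  simp [posX, List.count_replicate]
theorem posY_repN10 (k : ℕ) : posY (List.replicate k Step.N) = k := by
  simp [posY, List.count_replicate]
theorem posX_repE10 (k : ℕ) : posX (List.replicate k Step.E) = k := by
  simp [posX, List.count_replicate]
theorem posY_repE10 (k : ℕ) : posY (List.replicate k Step.E) = 0 := by
  simp [posY, List.count_replicate]
theorem posX_N10 : posX [Step.N] = 0 := by decide
theorem posY_N10 : posY [Step.N] = 1 := by decide
theorem posX_E10 : posX [Step.E] = 1 := by decide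
theorem posY_E10 : posY [Step.E] = 0 := by decide
theorem posX_D10 : posX [Step.D] = 1 := by decide
theorem posY_D10 : posY [Step.D] = 1 := by decide
theorem posX_nil10 : posX [] = 0 := by decide
theorem posY_nil10 : posY [] = 0 := by decide

theorem st10_height {b p} (h : St10 b p) : posY p = posX p + (if b then 1 else 0) := by
  induction h <;> simp_all [posX_append10, posY_append10, posX_repN10, posY_repN10, posX_repE10,
    posY_repE10, posX_N10, posY_N10, posX_E10, posY_E10, posX_D10, posY_D10, posX_nil10, posY_nil10]
  all_goals omega

theorem prefix_split10 {p a b : List Step} (h : p <+: a ++ b) :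
    p <+: a ∨ ∃ s, p = a ++ s ∧ s <+: b := by
  rcases List.prefix_or_prefix_of_prefix h (List.prefix_append a b) with h1 | ⟨s, rfl⟩
  · exact Or.inl h1
  · exact Or.inr ⟨s, rfl, (List.prefix_append_right_inj a).1 h⟩

/-- relative Schröder condition starting at height `c` -/
def Rel10 (c : ℕ) (p : List Step) : Prop := ∀ q, q <+: p → posX q ≤ posY q + c

theorem rel10_append {c d : ℕ} {a b : List Step} (ha : Rel10 c a) (hb : Rel10 d b)
    (h : posX a + d ≤ posY a + c) : Rel10 c (a ++ b) := by
  intro q hq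
  rcases prefix_split10 hq with h1 | ⟨s, rfl, hs⟩
  · exact ha q h1
  · have := hb s hs
    rw [posX_append10, posY_append10]; omega

theorem rel10_mono {c d : ℕ} {a : List Step} (ha : Rel10 c a) (h : c ≤ d) : Rel10 d a :=
  fun q hq => (ha q hq).trans (by omega)

theorem rel10_of_posX {c : ℕ} {a : List Step} (h : posX a ≤ c) : Rel10 c a := by
  rintro q ⟨s, rfl⟩
  rw [posX_append10] at h; omega

theorem rel10_repN (k : ℕ) : Rel10 0 (List.replicate k Step.N) :=
  rel10_of_posX (by rw [posX_repN10])

theorem rel10_D : Rel10 0 [Step.D] := by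
  intro q hq
  rcases List.prefix_cons_iff.1 hq with rfl | ⟨t, rfl, ht⟩
  · decide
  · rw [List.prefix_nil.1 ht]; decide

theorem inner10_good {p} (h : IsInnerWord p) : posX p = posY p ∧ Rel10 0 p := by
  induction h with
  | nil => exact ⟨rfl, rel10_of_posX (by decide)⟩
  | @dcons p _ ih =>
    rw [← List.singleton_append]
    refine ⟨by rw [posX_append10, posY_append10, ih.1]; rfl, rel10_append rel10_D ih.2 (by decide)⟩
  | @peak k p _ _ ih =>
    refine ⟨?_, rel10_append (rel10_append (d := k) (rel10_repN k) (rel10_of_posX ?_) ?_) ih.2 ?_⟩ <;>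
    simp only [posX_append10, posY_append10, posX_repN10, posY_repN10, posX_repE10, posY_repE10] <;>
    omega

theorem dword10_good {p} (h : IsDWord p) : posX p = posY p ∧ Rel10 0 p := by
  induction h with
  | nil => exact ⟨rfl, rel10_of_posX (by decide)⟩
  | @dcons p _ ih =>
    rw [← List.singleton_append]
    refine ⟨by rw [posX_append10, posY_append10, ih.1]; rfl, rel10_append rel10_D ih.2 (by decide)⟩
  | @block q p hq _ ih =>
    have hq := inner10_good hq
    rw [← List.singleton_append, ← List.singleton_append (l := p)]
    refine ⟨?_, rel10_append (d := 1) (rel10_repN 1)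
      (rel10_append (d := 1) (rel10_mono hq.2 (by omega))
        (rel10_append (d := 0) (rel10_of_posX ?_) ih.2 ?_) ?_) ?_⟩ <;>
    (try simp only [posX_append10, posY_append10, posX_N10, posY_N10, posX_E10, posY_E10]) <;>
    omega

theorem inner10_append {p q} (hp : IsInnerWord p) (hq : IsInnerWord q) : IsInnerWord (p ++ q) := by
  induction hp with
  | nil => exact hq
  | dcons _ ih => exact .dcons ih
  | peak hk _ ih => rw [List.append_assoc]; exact .peak hk ih

theorem st10_extend {b p} (h : St10 b p) :
    (b = false → ∀ q, IsDWord q → IsDWord (p ++ q)) ∧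
    (b = true → ∀ r q, IsInnerWord r → IsDWord q → IsDWord (p ++ (r ++ Step.E :: q))) := by
  induction h with
  | nil => exact ⟨fun _ q hq => hq, by simp⟩
  | ad _ ih =>
    refine ⟨fun _ q hq => ?_, by simp⟩
    rw [List.append_assoc]; exact ih.1 rfl _ (.dcons hq)
  | be _ ih =>
    refine ⟨fun _ q hq => ?_, by simp⟩
    rw [List.append_assoc]; exact ih.2 rfl [] q .nil hq
  | an _ ih =>
    refine ⟨by simp, fun _ r q hr hq => ?_⟩
    rw [List.append_assoc]; exact ih.1 rfl _ (.block hr hq)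
  | bd _ ih =>
    refine ⟨by simp, fun _ r q hr hq => ?_⟩
    rw [List.append_assoc]; exact ih.2 rfl _ q (.dcons hr) hq
  | bp k hk _ ih =>
    refine ⟨by simp, fun _ r q hr hq => ?_⟩
    have := ih.2 rfl _ q (.peak hk hr) hq
    simpa using this

/-- states of all prefixes -/
def Any10 (p : List Step) : Prop :=
  St10 false p ∨ ∃ w k j, St10 true w ∧ j ≤ k ∧
    p = w ++ (List.replicate k Step.N ++ List.replicate j Step.E)

theorem any10_of_true {p} (h : St10 true p) : Any10 p :=
  Or.inr ⟨p, 0, 0, h, le_rfl, by simp⟩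

theorem inner10_any {q} (h : IsInnerWord q) : ∀ w, St10 true w →
    St10 true (w ++ q) ∧ ∀ p, p <+: q → Any10 (w ++ p) := by
  induction h with
  | nil =>
    intro w hw
    refine ⟨by simpa using hw, fun p hp => ?_⟩
    rw [List.prefix_nil.1 hp]; simpa using any10_of_true hw
  | dcons _ ih =>
    intro w hw
    have := ih _ (.bd hw)
    refine ⟨by simpa using this.1, fun p hp => ?_⟩
    rcases List.prefix_cons_iff.1 hp with rfl | ⟨t, rfl, ht⟩
    · simpa using any10_of_true hw
    · simpa using this.2 t ht
  | @peak k q hk _ ih =>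
    intro w hw
    have := ih _ (.bp k hk hw)
    refine ⟨by simpa using this.1, fun p hp => ?_⟩
    rcases prefix_split10 hp with h1 | ⟨s, rfl, hs⟩
    · rcases prefix_split10 h1 with h2 | ⟨s, rfl, hs⟩
      · obtain ⟨hl, he⟩ := List.prefix_replicate_iff.1 h2
        exact Or.inr ⟨w, p.length, 0, hw, by omega, by rw [← he]; simp⟩
      · obtain ⟨hl, he⟩ := List.prefix_replicate_iff.1 hs
        exact Or.inr ⟨w, k, s.length, hw, hl, by rw [← he]⟩
    · simpa using this.2 s hs

theorem dword10_any {q} (h : IsDWord q) : ∀ w, St10 false w → ∀ p, p <+: q → Any10 (w ++ p) := by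
  induction h with
  | nil =>
    intro w hw p hp
    rw [List.prefix_nil.1 hp]; left; simpa using hw
  | dcons _ ih =>
    intro w hw p hp
    rcases List.prefix_cons_iff.1 hp with rfl | ⟨t, rfl, ht⟩
    · left; simpa using hw
    · simpa using ih _ (.ad hw) t ht
  | block hq _ ih =>
    intro w hw p hp
    rcases List.prefix_cons_iff.1 hp with rfl | ⟨t, rfl, ht⟩
    · left; simpa using hw
    have h1 := inner10_any hq _ (.an hw)
    rcases prefix_split10 ht with h2 | ⟨s, rfl, hs⟩
    · simpa using h1.2 t h2
    rcases List.prefix_cons_iff.1 hs with rfl | ⟨t, rfl, ht2⟩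
    · simpa using any10_of_true h1.1
    · simpa using ih _ (.be h1.1) t ht2

theorem mem10_iff {p} (hp : posX p + 1 = posY p) : MemCalD p ↔ St10 true p := by
  constructor
  · rintro ⟨m, q, hpq, hq, -⟩
    rcases dword10_any hq [] .nil p hpq with h | ⟨w, k, j, hw, hj, h⟩
    · have := st10_height h
      simp at this; omega
    · simp only [List.nil_append] at h
      subst h
      have := st10_height hw
      simp only [posX_append10, posY_append10, posX_repN10, posY_repN10, posX_repE10,
        posY_repE10, if_true] at this hp
      have hjk : j = k := by omega
      subst hjk
      rcases Nat.eq_zero_or_pos j with rfl | hj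
      · simpa using hw
      · exact .bp j hj hw
  · intro h
    have h1 := (st10_extend h).2 rfl [] [] .nil .nil
    have h2 := dword10_good h1
    exact ⟨_, _, List.prefix_append _ _, h1, h2.2, rfl, h2.1.symm⟩

def SA10 (i : ℕ) : Set (List Step) := {p | St10 false p ∧ posX p = i}
def SB10 (i : ℕ) : Set (List Step) := {p | St10 true p ∧ posX p + 1 = i}
def ST10 (i : ℕ) : Set (List Step × ℕ) := {t | St10 true t.1 ∧ 0 < t.2 ∧ posX t.1 + t.2 + 1 = i}

theorem bSeq10 (i : ℕ) : bSeq i = (SB10 i).ncard := by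
  unfold bSeq SB10
  congr 1
  ext p
  constructor
  · rintro ⟨h, h1, h2⟩
    exact ⟨(mem10_iff (by omega)).1 h, h1⟩
  · rintro ⟨h, h1⟩
    have := st10_height h
    simp only [if_true] at this
    exact ⟨(mem10_iff (by omega)).2 h, h1, by omega⟩

theorem len10 (p : List Step) : p.length ≤ posX p + posY p := by
  induction p with
  | nil => simp
  | cons a l ih =>
    rw [← List.singleton_append, posX_append10, posY_append10]
    have : 1 ≤ posX [a] + posY [a] := by cases a <;> decide
    simp; omega

theorem fin10 (N : ℕ) : {p : List Step | p.length ≤ N}.Finite := by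
  haveI : Finite Step := Finite.of_surjective
    (fun i : Fin 3 => if i = 0 then Step.E else if i = 1 then Step.N else Step.D) (by
      intro s; cases s
      · exact ⟨0, by decide⟩
      · exact ⟨1, by decide⟩
      · exact ⟨2, by decide⟩)
  exact List.finite_length_le Step N

theorem finA10 (i : ℕ) : (SA10 i).Finite := by
  refine (fin10 (2 * i)).subset ?_
  rintro p ⟨h, h1⟩
  have h2 := st10_height h
  have := len10 p
  simp at h2 ⊢; omega

theorem finB10 (i : ℕ) : (SB10 i).Finite := by
  refine (fin10 (2 * i)).subset ?_
  rintro p ⟨h, h1⟩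
  have h2 := st10_height h
  have := len10 p
  simp at h2 ⊢; omega

theorem finT10 (i : ℕ) : (ST10 i).Finite := by
  refine ((fin10 (2 * i)).prod (Set.finite_le_nat i)).subset ?_
  rintro ⟨p, k⟩ ⟨h, h1, h3⟩
  have h2 := st10_height h
  have := len10 p
  simp at h2 h3 ⊢; omega

theorem cardT10 (i : ℕ) : (ST10 (i+1)).ncard = (SB10 i).ncard + (ST10 i).ncard := by
  have : ST10 (i+1) = (fun w => (w, 1)) '' SB10 i ∪ (fun t => (t.1, t.2 + 1)) '' ST10 i := by
    ext ⟨w, k⟩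
    constructor
    · rintro ⟨h, h1, h2⟩
      simp only at h h1 h2
      rcases k with _ | _ | k
      · omega
      · exact Or.inl ⟨w, ⟨h, by omega⟩, rfl⟩
      · exact Or.inr ⟨(w, k+1), ⟨h, by simp, by simp only; omega⟩, rfl⟩
    · rintro (⟨w', ⟨h, h1⟩, h2⟩ | ⟨⟨w', k'⟩, ⟨h, h1, h3⟩, h2⟩)
      · simp only [Prod.mk.injEq] at h2
        obtain ⟨rfl, rfl⟩ := h2
        exact ⟨h, by simp, by simp only; omega⟩
      · simp only [Prod.mk.injEq] at h2 h h1 h3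
        obtain ⟨rfl, rfl⟩ := h2
        exact ⟨h, by simp, by simp only; omega⟩
  rw [this, Set.ncard_union_eq _ ((finB10 i).image _) ((finT10 i).image _),
    Set.ncard_image_of_injective, Set.ncard_image_of_injective]
  · rintro ⟨a, b⟩ ⟨c, d⟩ h; simpa using h
  · intro a b h; simpa using h
  · rw [Set.disjoint_left]
    rintro _ ⟨w, _, rfl⟩ ⟨⟨w', k⟩, ⟨_, h, _⟩, h'⟩
    simp at h h'; omega

theorem cardA10 (i : ℕ) : (SA10 (i+1)).ncard = (SA10 i).ncard + (SB10 (i+1)).ncard := by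
  have : SA10 (i+1) = (fun w => w ++ [Step.D]) '' SA10 i ∪ (fun w => w ++ [Step.E]) '' SB10 (i+1) := by
    ext w
    constructor
    · rintro ⟨h, h1⟩
      cases h with
      | nil => simp [posX] at h1
      | @ad p h =>
        rw [posX_append10, posX_D10] at h1
        exact Or.inl ⟨p, ⟨h, by omega⟩, rfl⟩
      | @be p h =>
        rw [posX_append10, posX_E10] at h1
        exact Or.inr ⟨p, ⟨h, by omega⟩, rfl⟩
    · rintro (⟨p, ⟨h, h1⟩, rfl⟩ | ⟨p, ⟨h, h1⟩, rfl⟩)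
      · exact ⟨.ad h, by simp only [posX_append10, posX_D10]; omega⟩
      · exact ⟨.be h, by simp only [posX_append10, posX_E10]; omega⟩
  rw [this, Set.ncard_union_eq _ ((finA10 i).image _) ((finB10 _).image _),
    Set.ncard_image_of_injective, Set.ncard_image_of_injective]
  · intro a b h; simpa using h
  · intro a b h; simpa using h
  · rw [Set.disjoint_left]
    rintro _ ⟨w, _, rfl⟩ ⟨w', _, h'⟩
    simp [List.append_eq_append_iff_of_size_eq_right] at h'

theorem peak10_inj (k : ℕ) : ∀ (l : ℕ) (w v : List Step),
    w ++ (List.replicate k Step.N ++ List.replicate k Step.E) =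
    v ++ (List.replicate l Step.N ++ List.replicate l Step.E) → 0 < k → 0 < l → k = l ∧ w = v := by
  intro l w v h hk hl
  have key : ∀ (k l : ℕ) (a b : List Step), a ++ [Step.N] ++ List.replicate k Step.E =
      b ++ [Step.N] ++ List.replicate l Step.E → k = l := by
    intro k
    induction k with
    | zero =>
      intro l a b h
      cases l with
      | zero => rfl
      | succ l =>
        rw [List.replicate_succ', ← List.append_assoc] at h
        simp only [List.replicate_zero, List.append_nil] at h
        have := (List.append_inj' h rfl).2
        simp at this
    | succ k ih =>
      intro l a b h
      cases l with
      | zero =>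
        rw [List.replicate_succ', ← List.append_assoc] at h
        simp only [List.replicate_zero, List.append_nil] at h
        have := (List.append_inj' h rfl).2
        simp at this
      | succ l =>
        rw [List.replicate_succ', List.replicate_succ', ← List.append_assoc, ← List.append_assoc] at h
        rw [ih l a b (List.append_inj' h rfl).1]
  have hkl : k = l := by
    obtain ⟨k', rfl⟩ : ∃ k', k = k' + 1 := ⟨k - 1, by omega⟩
    obtain ⟨l', rfl⟩ : ∃ l', l = l' + 1 := ⟨l - 1, by omega⟩
    refine key _ _ (w ++ List.replicate k' Step.N) (v ++ List.replicate l' Step.N) ?_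
    rw [List.replicate_succ' (a := Step.N), List.replicate_succ' (a := Step.N)] at h
    simpa only [List.append_assoc] using h
  subst hkl
  exact ⟨rfl, List.append_cancel_right h⟩

theorem peak10_last (k : ℕ) (hk : 0 < k) (w v : List Step) (s : Step)
    (h : w ++ (List.replicate k Step.N ++ List.replicate k Step.E) = v ++ [s]) : s = Step.E := by
  obtain ⟨k', rfl⟩ : ∃ k', k = k' + 1 := ⟨k - 1, by omega⟩
  rw [List.replicate_succ' (a := Step.E), ← List.append_assoc, ← List.append_assoc] at h
  have := (List.append_inj' h rfl).2
  simpa using this.symm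

theorem cardB10 (i : ℕ) : (SB10 (i+1)).ncard =
    (SA10 i).ncard + (SB10 i).ncard + (ST10 (i+1)).ncard := by
  have : SB10 (i+1) = ((fun w => w ++ [Step.N]) '' SA10 i ∪ (fun w => w ++ [Step.D]) '' SB10 i) ∪
      (fun t => t.1 ++ (List.replicate t.2 Step.N ++ List.replicate t.2 Step.E)) '' ST10 (i+1) := by
    ext w
    constructor
    · rintro ⟨h, h1⟩
      cases h with
      | @an p h =>
        rw [posX_append10, posX_N10] at h1
        exact Or.inl (Or.inl ⟨p, ⟨h, by omega⟩, rfl⟩)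
      | @bd p h =>
        rw [posX_append10, posX_D10] at h1
        exact Or.inl (Or.inr ⟨p, ⟨h, by omega⟩, rfl⟩)
      | @bp p k hk h =>
        rw [posX_append10, posX_append10, posX_repN10, posX_repE10] at h1
        exact Or.inr ⟨(p, k), ⟨h, hk, by simp only; omega⟩, rfl⟩
    · rintro ((⟨p, ⟨h, h1⟩, rfl⟩ | ⟨p, ⟨h, h1⟩, rfl⟩) | ⟨⟨p, k⟩, ⟨h, h1, h2⟩, rfl⟩)
      · exact ⟨.an h, by simp only [posX_append10, posX_N10]; omega⟩
      · exact ⟨.bd h, by simp only [posX_append10, posX_D10]; omega⟩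
      · simp only at h h1 h2
        exact ⟨.bp k h1 h, by simp only [posX_append10, posX_repN10, posX_repE10]; omega⟩
  rw [this, Set.ncard_union_eq _ (((finA10 i).image _).union ((finB10 _).image _)) ((finT10 _).image _),
    Set.ncard_union_eq _ ((finA10 i).image _) ((finB10 _).image _),
    Set.ncard_image_of_injective, Set.ncard_image_of_injective, Set.ncard_image_of_injOn]
  · rintro ⟨a, k⟩ ⟨_, ha, _⟩ ⟨b, l⟩ ⟨_, hb, _⟩ h
    obtain ⟨h1, h2⟩ := peak10_inj k l a b h ha hb
    rw [h1, h2]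
  · intro a b h; simpa using h
  · intro a b h; simpa using h
  · rw [Set.disjoint_left]
    rintro _ ⟨w, _, rfl⟩ ⟨w', _, h'⟩
    have := (List.append_inj' h' rfl).2
    simp at this
  · rw [Set.disjoint_left]
    rintro _ (⟨w, _, rfl⟩ | ⟨w, _, rfl⟩) ⟨⟨w', k⟩, ⟨_, hk, _⟩, h'⟩
    · have := peak10_last k hk _ _ _ h'
      simp at this
    · have := peak10_last k hk _ _ _ h'
      simp at this

theorem stmt_10 :
    bSeq 0 = 0 ∧ bSeq 1 = 1 ∧
      ∀ k : ℕ, 1 ≤ k → (bSeq (k + 1) : ℤ) = 4 * bSeq k - bSeq (k - 1) := by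
  simp only [bSeq10]
  have b0 : (SB10 0).ncard = 0 := by
    have : SB10 0 = ∅ := by ext p; simp [SB10]
    rw [this, Set.ncard_empty]
  have t0 : (ST10 0).ncard = 0 := by
    have : ST10 0 = ∅ := by ext p; simp [ST10]
    rw [this, Set.ncard_empty]
  have a0 : (SA10 0).ncard = 1 := by
    have : SA10 0 = {[]} := by
      ext p
      constructor
      · rintro ⟨h, h1⟩
        have h2 := st10_height h
        have := len10 p
        simp at h2
        exact List.length_eq_zero_iff.1 (by omega)
      · rintro rfl
        exact ⟨.nil, rfl⟩
    rw [this, Set.ncard_singleton]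
  have t1 := cardT10 0
  have b1 := cardB10 0
  simp only [zero_add] at t1 b1
  refine ⟨b0, by omega, ?_⟩
  intro k hk
  obtain ⟨j, rfl⟩ : ∃ j, k = j + 1 := ⟨k - 1, by omega⟩
  have h1 := cardB10 (j+1)
  have h2 := cardB10 j
  have h3 := cardA10 j
  have h4 := cardT10 (j+1)
  have h5 := cardT10 j
  simp only [Nat.add_sub_cancel]
  omega
end
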